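/- arXiv:1512.06401 — 4 statements merged into one kernel-verified Lean document; each statement's English description precedes it below -/
import Mathlib

section
/- Let N be a composite natural number and p a prime divisor of N with p ≤ b for some natural number b satisfying 5b ≤ N. Let r, m be natural numbers such that 2 ≤ m < p, gcd(N, m) = 1, and r = p mod m, and set k = ⌈(b/m)^{1/2}⌉. Then the two subsets of ℤ/Nℤ given by { m⁻¹·r − n mod N : 1 ≤ n ≤ k } and { −n·k mod N : 1 ≤ n ≤ k } are disjoint, where m⁻¹ denotes the inverse of m modulo N. -/
/-- With `k` the ceiling of `√(b / m)` and `m ≤ b`, one has `m * k ^ 2 ≤ 4 * b`. -/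
theorem mul_ceil_sqrt_div_sq_le {b m : ℕ} (hm : 0 < m) (hmb : m ≤ b) :
    m * ⌈Real.sqrt ((b : ℝ) / (m : ℝ))⌉₊ ^ 2 ≤ 4 * b := by
  set s := Real.sqrt ((b : ℝ) / (m : ℝ)) with hs
  have hm' : (0 : ℝ) < m := by exact_mod_cast hm
  have hs1 : 1 ≤ s := by
    rw [hs, Real.one_le_sqrt, one_le_div hm']
    exact_mod_cast hmb
  have hsq : (m : ℝ) * s ^ 2 = b := by
    rw [hs, Real.sq_sqrt (by positivity)]
    field_simp
  have hk : (⌈s⌉₊ : ℝ) ≤ 2 * s := by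
    linarith [Nat.ceil_lt_add_one (zero_le_one.trans hs1)]
  have : (m : ℝ) * (⌈s⌉₊ : ℝ) ^ 2 ≤ 4 * (b : ℝ) :=
    calc (m : ℝ) * (⌈s⌉₊ : ℝ) ^ 2 ≤ m * (2 * s) ^ 2 := by gcongr
      _ = 4 * (b : ℝ) := by rw [← hsq]; ring
  exact_mod_cast this

/-- The two sets `{m⁻¹·r − n : 1 ≤ n ≤ k}` and `{−n·k : 1 ≤ n ≤ k}`
in `ℤ/Nℤ` are disjoint. -/
theorem stmt_0 (N p b m r : ℕ) (hN : 1 < N) (hNcomp : ¬ N.Prime)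
    (hp : p.Prime) (hpN : p ∣ N) (hpb : p ≤ b) (hbN : 5 * b ≤ N)
    (hm2 : 2 ≤ m) (hmp : m < p) (hgcd : Nat.gcd N m = 1) (hr : r = p % m)
    (k : ℕ) (hk : k = ⌈Real.sqrt ((b : ℝ) / (m : ℝ))⌉₊) :
    Disjoint
      {x : ZMod N | ∃ n : ℕ, 1 ≤ n ∧ n ≤ k ∧ x = (m : ZMod N)⁻¹ * (r : ZMod N) - (n : ZMod N)}
      {x : ZMod N | ∃ n : ℕ, 1 ≤ n ∧ n ≤ k ∧ x = -((n : ZMod N) * (k : ZMod N))} := by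
  rw [Set.disjoint_left]
  rintro x ⟨n, hn1, hnk, rfl⟩ ⟨l, hl1, hlk, hx⟩
  have hkb : m * k ^ 2 ≤ 4 * b := hk ▸ mul_ceil_sqrt_div_sq_le (by omega) (by omega)
  have hr0 : 0 < r := by
    rw [hr, Nat.pos_iff_ne_zero]
    intro h
    rcases (Nat.dvd_prime hp).1 (Nat.dvd_of_mod_eq_zero h) with h | h <;> omega
  have hrm : r < m := hr ▸ Nat.mod_lt _ (by omega)
  obtain ⟨t, ht⟩ : ∃ t, l * k = n + t :=
    Nat.exists_eq_add_of_le (hnk.trans (Nat.le_mul_of_pos_left k hl1))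
  have htk : t + 1 ≤ k ^ 2 := by nlinarith
  have hmm : (m : ZMod N) * (m : ZMod N)⁻¹ = 1 :=
    ZMod.coe_mul_inv_eq_one m (Nat.Coprime.symm hgcd)
  have hlk' : (l : ZMod N) * k = n + t := by exact_mod_cast congrArg (Nat.cast (R := ZMod N)) ht
  have hzero : ((r + m * t : ℕ) : ZMod N) = 0 := by
    push_cast
    linear_combination (m : ZMod N) * hx - (r : ZMod N) * hmm - (m : ZMod N) * hlk'
  have hle := Nat.le_of_dvd (by omega) ((ZMod.natCast_eq_zero_iff _ _).1 hzero)
  nlinarith [Nat.mul_le_mul_left m htk, hp.pos]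
end

section
/- Let N be a composite natural number and p a prime divisor of N with p ≤ b for some natural number b satisfying 5b ≤ N. Let r, m be natural numbers such that 2 ≤ m < p, gcd(N, m) = 1, and r = p mod m, and set k = ⌈(b/m)^{1/2}⌉. Then there exist i, j ∈ {1, …, k} such that m⁻¹·r − i ≡ −j·k (mod p), i.e., in ℤ/pℤ one has (m)⁻¹·r − i = −(j·k), where (m)⁻¹ is the inverse of m modulo p. -/
/-- There exist `i, j ∈ {1, …, k}` such that `m⁻¹·r − i ≡ −j·k (mod p)`. -/
theorem stmt_1 (N p b m r : ℕ) (hN : 1 < N) (hNcomp : ¬ N.Prime)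
    (hp : p.Prime) (hpN : p ∣ N) (hpb : p ≤ b) (hbN : 5 * b ≤ N)
    (hm2 : 2 ≤ m) (hmp : m < p) (hgcd : Nat.gcd N m = 1) (hr : r = p % m)
    (k : ℕ) (hk : k = ⌈Real.sqrt ((b : ℝ) / (m : ℝ))⌉₊) :
    ∃ i j : ℕ, 1 ≤ i ∧ i ≤ k ∧ 1 ≤ j ∧ j ≤ k ∧
      (m : ZMod p)⁻¹ * (r : ZMod p) - (i : ZMod p) = -((j : ZMod p) * (k : ZMod p)) := by
  have : Fact p.Prime := ⟨hp⟩
  have hm0 : (0 : ℝ) < m := by exact_mod_cast (by omega : 0 < m)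
  have hbk : b ≤ k ^ 2 * m := by
    have h : Real.sqrt ((b : ℝ) / m) ≤ k := hk ▸ Nat.le_ceil _
    rw [Real.sqrt_le_left (Nat.cast_nonneg k), div_le_iff₀ hm0] at h
    exact_mod_cast h
  have hdm : m * (p / m) + r = p := hr ▸ Nat.div_add_mod p m
  have hr0 : 0 < r := by
    rw [hr, Nat.pos_iff_ne_zero]
    intro h
    rcases (Nat.dvd_prime hp).1 (Nat.dvd_of_mod_eq_zero h) with h | h <;> omega
  generalize p / m = q at hdm
  have hq : q < k * k := by
    by_contra! h
    have := Nat.mul_le_mul_left m h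
    have : k ^ 2 * m = m * (k * k) := by ring
    omega
  have hk0 : 0 < k := by
    rcases Nat.eq_zero_or_pos k with rfl | h
    · omega
    · exact h
  have hmz : (m : ZMod p) ≠ 0 := by
    rw [Ne, ZMod.natCast_eq_zero_iff]
    exact Nat.not_dvd_of_pos_of_lt (by omega) hmp
  have hlt := Nat.mod_lt q hk0
  have hqk := Nat.div_add_mod q k
  refine ⟨k - q % k, q / k + 1, by omega, by omega, Nat.le_add_left 1 _, Nat.div_lt_of_lt_mul hq, ?_⟩
  have hij : q + (k - q % k) = (q / k + 1) * k := by
    have : (q / k + 1) * k = k * (q / k) + k := by ring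
    omega
  have hijz := congrArg (Nat.cast : ℕ → ZMod p) hij
  have hdmz := congrArg (Nat.cast : ℕ → ZMod p) hdm
  rw [Nat.cast_mul, Nat.cast_add] at hijz
  rw [Nat.cast_add, Nat.cast_mul, ZMod.natCast_self] at hdmz
  have hrq : (m : ZMod p)⁻¹ * r = -q := by
    rw [inv_mul_eq_iff_eq_mul₀ hmz]
    linear_combination hdmz
  rw [hrq]
  linear_combination -hijz
end

section
/- Let N be a composite natural number and p a prime divisor of N with p ≤ b for some natural number b satisfying 5b ≤ N. Let r, m be natural numbers such that 2 ≤ m < p, gcd(N, m) = 1, and r = p mod m, and set k = ⌈(b/m)^{1/2}⌉. Then there exists j ∈ {1, …, k} such that the element ∏_{l=1}^{k} (−j·k − m⁻¹·r + l) of ℤ/Nℤ is not a unit, where m⁻¹ denotes the inverse of m modulo N. -/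
/-- There exists `j ∈ {1, …, k}` such that
`∏_{l=1}^{k} (−j·k − m⁻¹·r + l)` is not a unit in `ℤ/Nℤ`. -/
theorem stmt_2 (N p b m r : ℕ) (hN : 1 < N) (hNcomp : ¬ N.Prime)
    (hp : p.Prime) (hpN : p ∣ N) (hpb : p ≤ b) (hbN : 5 * b ≤ N)
    (hm2 : 2 ≤ m) (hmp : m < p) (hgcd : Nat.gcd N m = 1) (hr : r = p % m)
    (k : ℕ) (hk : k = ⌈Real.sqrt ((b : ℝ) / (m : ℝ))⌉₊) :
    ∃ j : ℕ, 1 ≤ j ∧ j ≤ k ∧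
      ¬ IsUnit (∏ l ∈ Finset.Icc 1 k,
        (-((j : ZMod N) * (k : ZMod N)) - (m : ZMod N)⁻¹ * (r : ZMod N) + (l : ZMod N))) := by
  have hbk : b ≤ k ^ 2 * m := by
    have hm0 : (0 : ℝ) < m := by exact_mod_cast (by omega : 0 < m)
    have h := (Real.sqrt_le_left (Nat.cast_nonneg k)).1 (hk ▸ Nat.le_ceil _)
    rw [div_le_iff₀ hm0] at h
    exact_mod_cast h
  have hdiv : m * (p / m) + r = p := hr ▸ Nat.div_add_mod p m
  have hr0 : 0 < r := by
    rw [hr, Nat.pos_iff_ne_zero]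
    intro h
    rcases (Nat.dvd_prime hp).1 (Nat.dvd_of_mod_eq_zero h) with h | h <;> omega
  have hq : p / m < k * k := by nlinarith
  have hk0 : 0 < k := Nat.pos_of_mul_pos_right (Nat.zero_lt_of_lt hq)
  have hqk := Nat.div_add_mod (p / m) k
  have hmod := Nat.mod_lt (p / m) hk0
  refine ⟨p / m / k + 1, Nat.le_add_left 1 _, Nat.div_lt_of_lt_mul hq, fun hunit => ?_⟩
  have hfactor := IsUnit.prod_iff.1 hunit (k - p / m % k) (Finset.mem_Icc.2 (by omega))
  have hmN : m.Coprime N := Nat.Coprime.symm hgcd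
  have hmul := ((ZMod.isUnit_iff_coprime m N).2 hmN).mul hfactor
  have hp_unit : IsUnit (p : ZMod N) := by
    rw [← IsUnit.neg_iff]
    convert hmul using 1
    have hinv := ZMod.coe_mul_inv_eq_one m hmN
    have hdiv' : (m : ZMod N) * (p / m : ℕ) + r = p := by exact_mod_cast congrArg Nat.cast hdiv
    have hqk' : (k : ZMod N) * (p / m / k : ℕ) + (p / m % k : ℕ) = (p / m : ℕ) := by
      exact_mod_cast congrArg Nat.cast hqk
    push_cast [Nat.cast_sub hmod.le]
    linear_combination hdiv' + r * hinv + m * hqk'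
  exact hp.one_lt.ne' (Nat.Coprime.eq_one_of_dvd ((ZMod.isUnit_iff_coprime p N).1 hp_unit) hpN)
end

section
/- Let N be a composite natural number and p a prime divisor of N with p ≤ b for some natural number b satisfying 5b ≤ N. Let r, m be natural numbers such that 2 ≤ m < p, gcd(N, m) = 1, and r = p mod m, and set k = ⌈(b/m)^{1/2}⌉. If j ∈ {1, …, k} is such that the element ∏_{l=1}^{k} (−j·k − m⁻¹·r + l) of ℤ/Nℤ is not a unit, then there exists i ∈ {1, …, k} such that gcd(v, N) is a nontrivial factor of N (i.e., 1 < gcd(v, N) < N), where v ∈ {0, 1, …, N−1} is the canonical representative of the element −j·k − m⁻¹·r + i of ℤ/Nℤ and m⁻¹ denotes the inverse of m modulo N. -/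
/-- If `1 < b / m`, then `k = ⌈√(b / m)⌉` satisfies `m * k ^ 2 < 4 * b`. -/
theorem mul_sq_ceil_sqrt_div_lt {b m : ℕ} (hm : 0 < m) (hmb : m < b) :
    m * ⌈Real.sqrt ((b : ℝ) / (m : ℝ))⌉₊ ^ 2 < 4 * b := by
  have hm' : (0 : ℝ) < m := by exact_mod_cast hm
  have hdiv : (1 : ℝ) < (b : ℝ) / m := by
    rw [one_lt_div hm']
    exact_mod_cast hmb
  have hs : 1 < Real.sqrt ((b : ℝ) / m) := Real.lt_sqrt_of_sq_lt (by simpa using hdiv)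
  have hsq : Real.sqrt ((b : ℝ) / m) ^ 2 * m = b := by
    rw [Real.sq_sqrt (by positivity)]
    field_simp
  have hk := Nat.ceil_lt_add_one (Real.sqrt_nonneg ((b : ℝ) / m))
  have hk2 : (⌈Real.sqrt ((b : ℝ) / m)⌉₊ : ℝ) ^ 2 < (2 * Real.sqrt ((b : ℝ) / m)) ^ 2 :=
    pow_lt_pow_left₀ (by linarith) (by positivity) two_ne_zero
  have : (m : ℝ) * (⌈Real.sqrt ((b : ℝ) / m)⌉₊ : ℝ) ^ 2 < 4 * b := by
    nlinarith [mul_lt_mul_of_pos_left hk2 hm']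
  exact_mod_cast this

/-- The element `-(j * k) - m⁻¹ * r + i` of `ZMod N` is nonzero when `0 < r < m`,
`1 ≤ i, j ≤ k` and `m * k ^ 2 ≤ N`. -/
theorem neg_mul_sub_inv_mul_add_ne_zero {N m r k i j : ℕ} (hgcd : Nat.gcd N m = 1)
    (hr : 0 < r) (hrm : r < m) (hi : 1 ≤ i) (hik : i ≤ k) (hj : 1 ≤ j) (hjk : j ≤ k)
    (hN : m * k ^ 2 ≤ N) :
    -((j : ZMod N) * (k : ZMod N)) - (m : ZMod N)⁻¹ * (r : ZMod N) + (i : ZMod N) ≠ 0 := by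
  intro h
  have hinv : (m : ZMod N) * (m : ZMod N)⁻¹ = 1 :=
    ZMod.coe_mul_inv_eq_one m (Nat.coprime_comm.mp hgcd)
  obtain ⟨c, hc⟩ := Nat.exists_eq_add_of_le (hik.trans (Nat.le_mul_of_pos_left k hj))
  have hc' : (j : ZMod N) * (k : ZMod N) = i + c := by exact_mod_cast congrArg Nat.cast hc
  have hzero : ((m * c + r : ℕ) : ZMod N) = 0 := by
    push_cast
    linear_combination (-(m : ZMod N)) * h - (m : ZMod N) * hc' - (r : ZMod N) * hinv
  have hle := Nat.le_of_dvd (by omega) ((ZMod.natCast_eq_zero_iff _ _).mp hzero)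
  have hck : c + 1 ≤ k ^ 2 := by nlinarith [Nat.mul_le_mul_right k hjk]
  nlinarith [Nat.mul_le_mul_left m hck]


/-- If `j ∈ {1, …, k}` is such that `∏_{l=1}^{k} (−j·k − m⁻¹·r + l)` is
not a unit in `ℤ/Nℤ`, then for some `i ∈ {1, …, k}`, the gcd of the canonical
representative of `−j·k − m⁻¹·r + i` with `N` is a nontrivial factor of `N`. -/
theorem stmt_3 (N p b m r : ℕ) (hN : 1 < N) (hNcomp : ¬ N.Prime)
    (hp : p.Prime) (hpN : p ∣ N) (hpb : p ≤ b) (hbN : 5 * b ≤ N)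
    (hm2 : 2 ≤ m) (hmp : m < p) (hgcd : Nat.gcd N m = 1) (hr : r = p % m)
    (k : ℕ) (hk : k = ⌈Real.sqrt ((b : ℝ) / (m : ℝ))⌉₊)
    (j : ℕ) (hj1 : 1 ≤ j) (hjk : j ≤ k)
    (hunit : ¬ IsUnit (∏ l ∈ Finset.Icc 1 k,
      (-((j : ZMod N) * (k : ZMod N)) - (m : ZMod N)⁻¹ * (r : ZMod N) + (l : ZMod N)))) :
    ∃ i : ℕ, 1 ≤ i ∧ i ≤ k ∧
      1 < Nat.gcd ((-((j : ZMod N) * (k : ZMod N)) - (m : ZMod N)⁻¹ * (r : ZMod N)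
            + (i : ZMod N)).val) N ∧
      Nat.gcd ((-((j : ZMod N) * (k : ZMod N)) - (m : ZMod N)⁻¹ * (r : ZMod N)
            + (i : ZMod N)).val) N < N := by
  subst hr
  have : NeZero N := ⟨by omega⟩
  have hr0 : 0 < p % m := Nat.pos_of_ne_zero fun h ↦ by
    rcases (Nat.dvd_prime hp).mp (Nat.dvd_of_mod_eq_zero h) with h | h <;> omega
  have hkN : m * k ^ 2 ≤ N := by
    have := mul_sq_ceil_sqrt_div_lt (b := b) (m := m) (by omega) (by omega)
    rw [← hk] at this
    omega
  rw [IsUnit.prod_iff] at hunit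
  push Not at hunit
  obtain ⟨i, hi, hu⟩ := hunit
  rw [Finset.mem_Icc] at hi
  have hne := neg_mul_sub_inv_mul_add_ne_zero hgcd hr0 (Nat.mod_lt p (by omega))
    hi.1 hi.2 hj1 hjk hkN
  refine ⟨i, hi.1, hi.2, ?_, ?_⟩
  · rw [← ZMod.natCast_zmod_val (_ + (i : ZMod N)), ZMod.isUnit_iff_coprime] at hu
    have hpos := Nat.gcd_pos_of_pos_right
      (-((j : ZMod N) * (k : ZMod N)) - (m : ZMod N)⁻¹ * ((p % m : ℕ) : ZMod N)
        + (i : ZMod N)).val (show 0 < N by omega)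
    exact lt_of_le_of_ne hpos (Ne.symm hu)
  · exact (Nat.gcd_le_left N (Nat.pos_of_ne_zero ((ZMod.val_ne_zero _).mpr hne))).trans_lt
      (ZMod.val_lt _)
end
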